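/- Let m be a positive integer and q ∈ [q_f(m), m+1]. Let c, d, e ∈ A'_q with f_{c,d}(q) ≤ 0 and f_{e,d}(q) ≤ 0, and suppose e > c in the lexicographic order. Then q_{e,d} < q_{c,d}, where for each pair (u,v) with f_{u,v}(q) ≤ 0, q_{u,v} denotes the unique zero of f_{u,v} in [q, m+1]. -/

import Mathlib

/-- A sequence of digits has a last nonzero digit. -/
def hasLastNonzero (c : ℕ → ℕ) : Prop := ∃ n, c n ≠ 0 ∧ ∀ i > n, c i = 0

/-- `c` (with `c i` the `(i+1)`-st digit) is a `q`-expansion of `x`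
with respect to the digit set `Ω_m = {0,1,…,m}`. -/
def isExpansion (m : ℕ) (q : ℝ) (x : ℝ) (c : ℕ → ℕ) : Prop :=
  (∀ i, c i ≤ m) ∧ x = ∑' i : ℕ, (c i : ℝ) / q ^ (i + 1)

/-- The set `U_q` of points of `I_q = [0, m/(q-1)]` with a unique `q`-expansion. -/
def Uq (m : ℕ) (q : ℝ) : Set ℝ :=
  {x | x ∈ Set.Icc 0 ((m : ℝ) / (q - 1)) ∧ ∃! c, isExpansion m q x c}

/-- The set `U'_q` of digit sequences that are unique `q`-expansions. -/
def Uq' (m : ℕ) (q : ℝ) : Set (ℕ → ℕ) :=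
  {c | isExpansion m q (∑' i : ℕ, (c i : ℝ) / q ^ (i + 1)) c ∧
       ∀ d, isExpansion m q (∑' i : ℕ, (c i : ℝ) / q ^ (i + 1)) d → d = c}

/-- `B_2(m)`: bases `q ∈ (1, m+1]` for which some `x ∈ I_q` has exactly two
different `q`-expansions. -/
def B2 (m : ℕ) : Set ℝ :=
  {q | q ∈ Set.Ioc 1 ((m : ℝ) + 1) ∧
    ∃ x ∈ Set.Icc (0 : ℝ) ((m : ℝ) / (q - 1)), ∃ a b : ℕ → ℕ,
      a ≠ b ∧ isExpansion m q x a ∧ isExpansion m q x b ∧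
      ∀ c, isExpansion m q x c → c = a ∨ c = b}

/-- Strict lexicographic order on digit sequences. -/
def lexLt (a b : ℕ → ℕ) : Prop := ∃ n, (∀ i < n, a i = b i) ∧ a n < b n

/-- Lexicographic order on digit sequences. -/
def lexLe (a b : ℕ → ℕ) : Prop := lexLt a b ∨ a = b

/-- `a` is the quasi-greedy `q`-expansion of `1`: the lexicographically largest
`q`-expansion of `1` without a last nonzero digit. -/
def isQuasiGreedy (m : ℕ) (q : ℝ) (a : ℕ → ℕ) : Prop :=
  isExpansion m q 1 a ∧ ¬ hasLastNonzero a ∧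
  ∀ b, isExpansion m q 1 b → ¬ hasLastNonzero b → lexLe b a

/-- `A'_q = {(c_i) ∈ U'_q : c_1 < α_1(q)}`. -/
def Aq' (m : ℕ) (q : ℝ) : Set (ℕ → ℕ) :=
  {c | c ∈ Uq' m q ∧ ∀ a, isQuasiGreedy m q a → c 0 < a 0}

/-- `f_{c,d}(t) = (m+1)/t + Σ_{i≥1} (c_i + d_i) t^{-(i+1)} - m/(t-1)`. -/
noncomputable def fcd (m : ℕ) (c d : ℕ → ℕ) (t : ℝ) : ℝ :=
  ((m : ℝ) + 1) / t + (∑' i : ℕ, ((c i : ℝ) + (d i : ℝ)) / t ^ (i + 2)) - (m : ℝ) / (t - 1)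

/-- `x = q_f(m)`: the largest real root of `q³-(k+2)q²+q-(k+1)=0` if `m = 2k+1`,
and of `q²-(k+1)q-k=0` if `m = 2k`. -/
def isQf (m : ℕ) (x : ℝ) : Prop :=
  (∃ k : ℕ, m = 2 * k + 1 ∧
    x ^ 3 - ((k : ℝ) + 2) * x ^ 2 + x - ((k : ℝ) + 1) = 0 ∧
    ∀ y : ℝ, y ^ 3 - ((k : ℝ) + 2) * y ^ 2 + y - ((k : ℝ) + 1) = 0 → y ≤ x) ∨
  (∃ k : ℕ, m = 2 * k ∧
    x ^ 2 - ((k : ℝ) + 1) * x - (k : ℝ) = 0 ∧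
    ∀ y : ℝ, y ^ 2 - ((k : ℝ) + 1) * y - (k : ℝ) = 0 → y ≤ x)

/-- A doubly infinite sequence: neither it nor its reflection has a last nonzero digit. -/
def doublyInfinite (m : ℕ) (c : ℕ → ℕ) : Prop :=
  ¬ hasLastNonzero c ∧ ¬ hasLastNonzero (fun i => m - c i)

/-- `V_q`: points of `I_q` with at most one doubly infinite `q`-expansion. -/
def Vq (m : ℕ) (q : ℝ) : Set ℝ :=
  {x | x ∈ Set.Icc 0 ((m : ℝ) / (q - 1)) ∧
    ∀ a b : ℕ → ℕ, isExpansion m q x a → isExpansion m q x b →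
      doublyInfinite m a → doublyInfinite m b → a = b}

/-- `U = {q ∈ (1, m+1] : 1 ∈ U_q}`. -/
def Uset (m : ℕ) : Set ℝ := {q | q ∈ Set.Ioc 1 ((m : ℝ) + 1) ∧ (1 : ℝ) ∈ Uq m q}

/-- `V = {q ∈ (1, m+1] : 1 ∈ V_q}`. -/
def Vset (m : ℕ) : Set ℝ := {q | q ∈ Set.Ioc 1 ((m : ℝ) + 1) ∧ (1 : ℝ) ∈ Vq m q}

/-- The generalized golden ratio `G(m)`. -/
noncomputable def Gratio (m : ℕ) : ℝ :=
  if m % 2 = 0 then ((m / 2 : ℕ) : ℝ) + 1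
  else (((m / 2 : ℕ) : ℝ) + 1 +
    Real.sqrt (((m / 2 : ℕ) : ℝ) ^ 2 + 6 * ((m / 2 : ℕ) : ℝ) + 5)) / 2

/-- The set of accumulation points of a set of reals. -/
def accPts (S : Set ℝ) : Set ℝ := {x | AccPt x (Filter.principal S)}

/-- Iterated accumulation-point sets `B_2^{(i)}(m)`. -/
def B2iter (m : ℕ) : ℕ → Set ℝ
  | 0 => B2 m
  | n + 1 => accPts (B2iter m n)

open Filter Topology in
/-- Every point of `[0, m/(q-1)]` has a `q`-expansion when `1 < q ≤ m + 1`. -/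
theorem exists_isExpansion {m : ℕ} {q : ℝ} (hq1 : 1 < q) (hqm : q ≤ m + 1) {x : ℝ}
    (hx : x ∈ Set.Icc 0 ((m : ℝ) / (q - 1))) : ∃ b, isExpansion m q x b := by
  have hq0 : 0 < q := by linarith
  let digit : ℝ → ℕ := fun y => min m ⌊q * y⌋₊
  let X : ℕ → ℝ := fun n => (fun y => q * y - digit y)^[n] x
  have hXs (n : ℕ) : X (n + 1) = q * X n - digit (X n) := by
    simp only [X, Function.iterate_succ_apply']
  have hX (n : ℕ) : X n ∈ Set.Icc 0 ((m : ℝ) / (q - 1)) := by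
    induction n with
    | zero => exact hx
    | succ n ih =>
      obtain ⟨h0, h1⟩ := ih
      have hqX : 0 ≤ q * X n := by positivity
      rw [hXs]
      rcases le_total m ⌊q * X n⌋₊ with h | h
      · have hd : digit (X n) = m := min_eq_left h
        rw [hd]
        refine ⟨by linarith [(Nat.le_floor_iff hqX).1 h], ?_⟩
        have hfix : q * ((m : ℝ) / (q - 1)) - m = (m : ℝ) / (q - 1) := by
          have : q - 1 ≠ 0 := by linarith
          field_simp
          ring
        linarith [mul_le_mul_of_nonneg_left h1 hq0.le]
      · have hd : digit (X n) = ⌊q * X n⌋₊ := min_eq_right h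
        rw [hd]
        refine ⟨by linarith [Nat.floor_le hqX], ?_⟩
        have : 1 ≤ (m : ℝ) / (q - 1) := by
          rw [le_div_iff₀ (by linarith)]
          linarith
        linarith [Nat.lt_floor_add_one (q * X n)]
  refine ⟨fun n => digit (X n), fun n => min_le_left _ _, ?_⟩
  have hpartial (n : ℕ) :
      ∑ i ∈ Finset.range n, (digit (X i) : ℝ) / q ^ (i + 1) = x - X n / q ^ n := by
    induction n with
    | zero => simp [X]
    | succ n ih =>
      rw [Finset.sum_range_succ, ih, hXs]
      field_simp
      ring
  refine (HasSum.tsum_eq ?_).symm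
  rw [hasSum_iff_tendsto_nat_of_nonneg (fun i => by positivity)]
  simp only [hpartial]
  have hpow : Tendsto (fun n => (m : ℝ) / (q - 1) * (1 / q) ^ n) atTop (𝓝 0) := by
    simpa using (tendsto_pow_atTop_nhds_zero_of_lt_one (by positivity)
      ((div_lt_one hq0).2 hq1)).const_mul ((m : ℝ) / (q - 1))
  have hrem : Tendsto (fun n => X n / q ^ n) atTop (𝓝 0) := by
    refine squeeze_zero (fun n => div_nonneg (hX n).1 (by positivity)) (fun n => ?_) hpow
    rw [one_div, inv_pow, ← div_eq_mul_inv]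
    exact div_le_div_of_nonneg_right (hX n).2 (by positivity)
  simpa using hrem.const_sub x

/-- The value of the digit sequence `c` in base `t`. -/
noncomputable def expansionValue (t : ℝ) (c : ℕ → ℕ) : ℝ := ∑' i : ℕ, (c i : ℝ) / t ^ (i + 1)

theorem hasSum_const_div_pow (m : ℕ) {t : ℝ} (ht : 1 < t) :
    HasSum (fun i : ℕ => (m : ℝ) / t ^ (i + 1)) ((m : ℝ) / (t - 1)) := by
  have h := (hasSum_geometric_of_lt_one (r := 1 / t) (by positivity)
    ((div_lt_one (by linarith)).2 ht)).mul_left ((m : ℝ) / t)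
  have ht0 : t ≠ 0 := by linarith
  have hterm : (fun i : ℕ => (m : ℝ) / t ^ (i + 1)) = fun i => (m : ℝ) / t * (1 / t) ^ i := by
    ext i
    rw [one_div, inv_pow, ← div_eq_mul_inv, div_div, ← pow_succ']
  have hsum : (m : ℝ) / (t - 1) = (m : ℝ) / t * (1 - 1 / t)⁻¹ := by
    rw [one_sub_div ht0]
    field_simp
  rwa [hterm, hsum]

section
variable {m : ℕ} {c e : ℕ → ℕ} {t : ℝ}

theorem summable_digits (hc : ∀ i, c i ≤ m) (ht : 1 < t) :
    Summable fun i : ℕ => (c i : ℝ) / t ^ (i + 1) := by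
  refine Summable.of_nonneg_of_le (fun i => by positivity) (fun i => ?_)
    (hasSum_const_div_pow m ht).summable
  have := hc i
  gcongr

theorem expansionValue_nonneg (c : ℕ → ℕ) (ht : 1 < t) : 0 ≤ expansionValue t c :=
  tsum_nonneg fun i => by positivity

theorem expansionValue_le (hc : ∀ i, c i ≤ m) (ht : 1 < t) :
    expansionValue t c ≤ (m : ℝ) / (t - 1) := by
  rw [← (hasSum_const_div_pow m ht).tsum_eq]
  refine (summable_digits hc ht).tsum_le_tsum (fun i => ?_) (hasSum_const_div_pow m ht).summable
  have := hc i
  gcongr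

/-- Splitting off the first `n + 1` digits. -/
theorem expansionValue_eq (hc : ∀ i, c i ≤ m) (ht : 1 < t) (n : ℕ) :
    expansionValue t c = ∑ i ∈ Finset.range n, (c i : ℝ) / t ^ (i + 1) +
      (c n + expansionValue t fun i => c (i + (n + 1))) / t ^ (n + 1) := by
  rw [expansionValue, ← (summable_digits hc ht).sum_add_tsum_nat_add (n + 1),
    Finset.sum_range_succ, add_assoc, add_div, expansionValue, ← tsum_div_const]
  congr 3
  ext i
  rw [div_div, ← pow_add]
  congr 2
  ring

theorem expansionValue_anti {q : ℝ} (hc : ∀ i, c i ≤ m) (hq : 1 < q) (hqt : q ≤ t) :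
    expansionValue t c ≤ expansionValue q c := by
  refine (summable_digits hc (hq.trans_le hqt)).tsum_le_tsum (fun i => ?_) (summable_digits hc hq)
  gcongr

/-- In a unique expansion, the tail after a digit smaller than `m` has value less than `1`. -/
theorem expansionValue_tail_lt_one {q : ℝ} (hq : 1 < q) (hqm : q ≤ m + 1) (hc : c ∈ Uq' m q)
    {n : ℕ} (hn : c n < m) : expansionValue q (fun i => c (i + (n + 1))) < 1 := by
  obtain ⟨⟨hcm, -⟩, huniq⟩ := hc
  by_contra! h
  obtain ⟨b, hbm, hb⟩ := exists_isExpansion hq hqm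
    (x := expansionValue q (fun i => c (i + (n + 1))) - 1)
    ⟨by linarith, by linarith [expansionValue_le (fun i => hcm (i + (n + 1))) hq]⟩
  let d : ℕ → ℕ := fun i => if i < n then c i else if i = n then c n + 1 else b (i - (n + 1))
  have hdn : d n = c n + 1 := by simp [d]
  have hdm (i : ℕ) : d i ≤ m := by
    simp only [d]
    split_ifs
    exacts [hcm i, hn, hbm _]
  have htail : (fun i => d (i + (n + 1))) = b := by
    ext i
    simp only [d]
    rw [if_neg (by omega), if_neg (by omega), Nat.add_sub_cancel]
  have hval : expansionValue q c = expansionValue q d := by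
    rw [expansionValue_eq hcm hq n, expansionValue_eq hdm hq n, htail, hdn]
    congr 1
    · refine Finset.sum_congr rfl fun i hi => ?_
      simp [d, Finset.mem_range.1 hi]
    · rw [← show _ = expansionValue q b from hb]
      push_cast
      ring
  have := congrFun (huniq d ⟨hdm, hval⟩) n
  omega

/-- A lexicographically larger sequence has a larger value, provided the tail of the smaller one
after the first difference has value less than `1`. -/
theorem expansionValue_lt (ht : 1 < t) (hc : ∀ i, c i ≤ m) (he : ∀ i, e i ≤ m) {n : ℕ}
    (heq : ∀ i < n, c i = e i) (hlt : c n < e n)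
    (htail : expansionValue t (fun i => c (i + (n + 1))) < 1) :
    expansionValue t c < expansionValue t e := by
  have hsum : ∑ i ∈ Finset.range n, (c i : ℝ) / t ^ (i + 1) =
      ∑ i ∈ Finset.range n, (e i : ℝ) / t ^ (i + 1) :=
    Finset.sum_congr rfl fun i hi => by rw [heq i (Finset.mem_range.1 hi)]
  have hle : (c n : ℝ) + 1 ≤ e n := by exact_mod_cast hlt
  rw [expansionValue_eq hc ht n, expansionValue_eq he ht n, hsum]
  gcongr _ + ?_ / _
  linarith [expansionValue_nonneg (fun i => e (i + (n + 1))) ht]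

theorem continuousOn_expansionValue {q : ℝ} (hc : ∀ i, c i ≤ m) (hq : 1 < q) :
    ContinuousOn (fun t => expansionValue t c) (Set.Ici q) := by
  have hpos {t : ℝ} (ht : t ∈ Set.Ici q) : 0 < t := by linarith [Set.mem_Ici.1 ht]
  refine continuousOn_tsum (fun i => ?_) (hasSum_const_div_pow m hq).summable fun i t ht => ?_
  · exact continuousOn_const.div (by fun_prop) fun t ht => (pow_pos (hpos ht) _).ne'
  · have := hpos ht
    have := hc i
    have : q ≤ t := ht
    rw [Real.norm_of_nonneg (by positivity)]
    gcongr

theorem fcd_eq {d : ℕ → ℕ} (hc : ∀ i, c i ≤ m) (hd : ∀ i, d i ≤ m) (ht : 1 < t) :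
    fcd m c d t =
      ((m : ℝ) + 1) / t + (expansionValue t c + expansionValue t d) / t - (m : ℝ) / (t - 1) := by
  rw [fcd, expansionValue, expansionValue,
    ← (summable_digits hc ht).tsum_add (summable_digits hd ht), ← tsum_div_const]
  congr 3
  ext i
  rw [← add_div, div_div, ← pow_succ]

theorem continuousOn_fcd {d : ℕ → ℕ} {q : ℝ} (hc : ∀ i, c i ≤ m) (hd : ∀ i, d i ≤ m)
    (hq : 1 < q) : ContinuousOn (fcd m c d) (Set.Ici q) := by
  have hgt {t : ℝ} (ht : t ∈ Set.Ici q) : 1 < t := hq.trans_le ht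
  refine ContinuousOn.congr ?_ fun t ht => fcd_eq hc hd (hgt ht)
  have h0 (t : ℝ) (ht : t ∈ Set.Ici q) : t ≠ 0 := by linarith [hgt ht]
  have h1 (t : ℝ) (ht : t ∈ Set.Ici q) : t - 1 ≠ 0 := by linarith [hgt ht]
  exact ((continuousOn_const.div continuousOn_id h0).add
    (((continuousOn_expansionValue hc hq).add (continuousOn_expansionValue hd hq)).div
      continuousOn_id h0)).sub (continuousOn_const.div (by fun_prop) h1)

end

theorem one_lt_of_isQf {m : ℕ} (hm : 0 < m) {x : ℝ} (hx : isQf m x) : 1 < x := by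
  rcases hx with ⟨k, -, hroot, -⟩ | ⟨k, rfl, hroot, hmax⟩
  · by_contra! h
    have hk : (0 : ℝ) ≤ k := k.cast_nonneg
    have hx0 : x = 0 := by
      by_contra hne
      have : 0 < x ^ 2 := by positivity
      nlinarith
    subst hx0
    linarith
  · have hk : (1 : ℝ) ≤ k := by exact_mod_cast (by omega : 1 ≤ k)
    have hconj := hmax (k + 1 - x) (by linear_combination hroot)
    by_contra! h
    nlinarith

/-- If `e > c` lexicographically and `r = q_{c,d}`, `s = q_{e,d}`
are the unique zeros of `f_{c,d}`, `f_{e,d}` in `[q, m+1]`, then `s < r`. -/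
theorem stmt11 (m : ℕ) (hm : 0 < m) (qf : ℝ) (hqf : isQf m qf)
    (q : ℝ) (hq : q ∈ Set.Icc qf ((m : ℝ) + 1))
    (c d e : ℕ → ℕ) (hc : c ∈ Aq' m q) (hd : d ∈ Aq' m q) (he : e ∈ Aq' m q)
    (hcd : fcd m c d q ≤ 0) (hed : fcd m e d q ≤ 0)
    (hlex : lexLt c e)
    (r s : ℝ)
    (hr : r ∈ Set.Icc q ((m : ℝ) + 1) ∧ fcd m c d r = 0 ∧
      ∀ p ∈ Set.Icc q ((m : ℝ) + 1), fcd m c d p = 0 → p = r)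
    (hs : s ∈ Set.Icc q ((m : ℝ) + 1) ∧ fcd m e d s = 0 ∧
      ∀ p ∈ Set.Icc q ((m : ℝ) + 1), fcd m e d p = 0 → p = s) :
    s < r := by
  have hq1 : 1 < q := (one_lt_of_isQf hm hqf).trans_le hq.1
  have hcm := hc.1.1.1
  have hdm := hd.1.1.1
  have hem := he.1.1.1
  obtain ⟨n, heq, hlt⟩ := hlex
  obtain ⟨⟨hqr, hrm⟩, hr0, -⟩ := hr
  have hr1 : 1 < r := hq1.trans_le hqr
  have htail : expansionValue r (fun i => c (i + (n + 1))) < 1 :=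
    (expansionValue_anti (fun i => hcm (i + (n + 1))) hq1 hqr).trans_lt
      (expansionValue_tail_lt_one hq1 hq.2 hc.1 (hlt.trans_le (hem n)))
  have hpos : 0 < fcd m e d r := by
    rw [← hr0, fcd_eq hcm hdm hr1, fcd_eq hem hdm hr1]
    have := expansionValue_lt hr1 hcm hem heq hlt htail
    gcongr
  obtain ⟨p, hp, hp0⟩ := intermediate_value_Ico hqr
    ((continuousOn_fcd hem hdm hq1).mono Set.Icc_subset_Ici_self) ⟨hed, hpos⟩
  rw [← hs.2.2 p ⟨hp.1, hp.2.le.trans hrm⟩ hp0]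
  exact hp.2
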